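/- Let R > 0 be a real number and set D₁ = 64 + R⁶ − 16R³(R+1)(4R²+8R+1) and D₂ = 4 − R³(R+1) + R⁶/16. If D₁ ≠ 0 and D₂ ≠ 0, then for every natural number n, ∑_{k=0}^{n} P_R(2k)³ = (4/(R³(R+2))) · [ (64·P_R(6) − 64·P_R(6n+6) + R⁶·P_R(6n))/D₁ − 3·(2R² − (R²/4)^{n+1}·(4·P_R(2n+2) − (R⁴/4)·P_R(2n)))/D₂ ]. -/

import Mathlib

/-- Generalized Pell numbers `P_R(n) = (2/(R·W))·(λⁿ − μⁿ)` with `W = √(R²+2R)`,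
`λ = (R+W)/2`, `μ = (R−W)/2`. -/
noncomputable def PR (R : ℝ) (n : ℕ) : ℝ :=
  (2 / (R * Real.sqrt (R ^ 2 + 2 * R))) *
    (((R + Real.sqrt (R ^ 2 + 2 * R)) / 2) ^ n - ((R - Real.sqrt (R ^ 2 + 2 * R)) / 2) ^ n)

/-- Partial sums of a second-order linear recurrence with `a 0 = 0`. -/
theorem mul_sum_range_of_recurrence {A : Type*} [CommRing A] (a : ℕ → A) (t q : A) (h0 : a 0 = 0)
    (h : ∀ k, a (k + 2) = t * a (k + 1) - q * a k) (n : ℕ) :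
    (1 - t + q) * ∑ k ∈ Finset.range (n + 1), a k = a 1 - a (n + 1) + q * a n := by
  induction n with
  | zero => simp [h0]
  | succ n ih =>
    rw [Finset.sum_range_succ, mul_add, ih, h n]
    ring

theorem PR_zero (R : ℝ) : PR R 0 = 0 := by simp [PR]

theorem PR_two {R : ℝ} (hR : 0 < R) : PR R 2 = 2 := by
  have hW : 0 < Real.sqrt (R ^ 2 + 2 * R) := Real.sqrt_pos.2 (by positivity)
  rw [PR]
  field_simp
  ring

theorem PR_add_two_step {R : ℝ} (hR : 0 < R) (n : ℕ) :
    PR R (n + 4) = R * (R + 1) * PR R (n + 2) - R ^ 2 / 4 * PR R n := by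
  have hW : Real.sqrt (R ^ 2 + 2 * R) ^ 2 = R ^ 2 + 2 * R := Real.sq_sqrt (by positivity)
  simp only [PR]
  set W := Real.sqrt (R ^ 2 + 2 * R)
  have hl : ((R + W) / 2) ^ 4 = R * (R + 1) * ((R + W) / 2) ^ 2 - R ^ 2 / 4 := by
    linear_combination (W ^ 2 / 16 + R * W / 4 + 3 * R ^ 2 / 16 - R / 8) * hW
  have hm : ((R - W) / 2) ^ 4 = R * (R + 1) * ((R - W) / 2) ^ 2 - R ^ 2 / 4 := by
    linear_combination (W ^ 2 / 16 - R * W / 4 + 3 * R ^ 2 / 16 - R / 8) * hW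
  simp only [pow_add _ n, hl, hm]
  ring

theorem PR_add_six_step {R : ℝ} (hR : 0 < R) (n : ℕ) :
    PR R (n + 12) =
      R ^ 3 * (R + 1) * (4 * R ^ 2 + 8 * R + 1) / 4 * PR R (n + 6) - R ^ 6 / 64 * PR R n := by
  have h0 := PR_add_two_step hR n
  have h2 := PR_add_two_step hR (n + 2)
  have h4 := PR_add_two_step hR (n + 4)
  have h6 := PR_add_two_step hR (n + 6)
  have h8 := PR_add_two_step hR (n + 8)
  simp only [add_assoc, Nat.reduceAdd] at h2 h4 h6 h8
  rw [h8, h6, h4, h2, h0]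
  ring

theorem PR_two_mul_cube {R : ℝ} (hR : 0 < R) (k : ℕ) :
    PR R (2 * k) ^ 3 =
      4 / (R ^ 3 * (R + 2)) * (PR R (6 * k) - 3 * ((R ^ 2 / 4) ^ k * PR R (2 * k))) := by
  have hpos : 0 < R ^ 2 + 2 * R := by positivity
  have hW : Real.sqrt (R ^ 2 + 2 * R) ^ 2 = R ^ 2 + 2 * R := Real.sq_sqrt hpos.le
  have hW0 : 0 < Real.sqrt (R ^ 2 + 2 * R) := Real.sqrt_pos.2 hpos
  simp only [PR]
  set W := Real.sqrt (R ^ 2 + 2 * R)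
  have hc : R ^ 2 / 4 = ((R + W) / 2) ^ 2 * ((R - W) / 2) ^ 2 := by
    linear_combination -(2 * R + W ^ 2 - R ^ 2) / 16 * hW
  have hf : 4 / (R ^ 3 * (R + 2)) = (2 / (R * W)) ^ 2 := by
    rw [div_pow, mul_pow, hW]
    field_simp
    ring
  rw [hf, hc, mul_pow (_ ^ 2), ← pow_mul, ← pow_mul, show 6 * k = 2 * k * 3 by ring,
    pow_mul _ (2 * k), pow_mul _ (2 * k)]
  ring

/-- Closed form for `∑_{k=0}^{n} P_R(2k)³`. -/
theorem PR_sum_of_cubes_even (R : ℝ) (hR : 0 < R) (D₁ D₂ : ℝ)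
    (hD₁def : D₁ = 64 + R ^ 6 - 16 * R ^ 3 * (R + 1) * (4 * R ^ 2 + 8 * R + 1))
    (hD₂def : D₂ = 4 - R ^ 3 * (R + 1) + R ^ 6 / 16)
    (hD₁ : D₁ ≠ 0) (hD₂ : D₂ ≠ 0) (n : ℕ) :
    ∑ k ∈ Finset.range (n + 1), PR R (2 * k) ^ 3 =
      4 / (R ^ 3 * (R + 2)) *
        ((64 * PR R 6 - 64 * PR R (6 * n + 6) + R ^ 6 * PR R (6 * n)) / D₁ -
          3 * (2 * R ^ 2 -
              (R ^ 2 / 4) ^ (n + 1) * (4 * PR R (2 * n + 2) - R ^ 4 / 4 * PR R (2 * n))) / D₂) := by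
  have h₁ := mul_sum_range_of_recurrence (fun k => PR R (6 * k)) _ _ (PR_zero R)
    (fun k => PR_add_six_step hR (6 * k)) n
  have h₂ := mul_sum_range_of_recurrence (fun k => (R ^ 2 / 4) ^ k * PR R (2 * k))
    (R ^ 3 * (R + 1) / 4) (R ^ 6 / 64) (by simp [PR_zero]) (fun k => by
      simp only [mul_add, Nat.reduceMul, PR_add_two_step hR (2 * k)]
      ring) n
  simp only [mul_add, mul_one, PR_two hR] at h₁ h₂
  simp only [PR_two_mul_cube hR, ← Finset.mul_sum, Finset.sum_sub_distrib]
  congr 2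
  · rw [eq_div_iff hD₁, hD₁def]
    linear_combination 64 * h₁
  · rw [eq_div_iff hD₂, hD₂def]
    linear_combination 12 * h₂
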